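/- For every ε > 0 there exists an open, simply connected subset U ⊆ ℂ with Σ_H ⊆ U and Lebesgue measure of U strictly less than ‖H‖_L + ε. (This is the upper-bound half of the paper's claim that the shadow of a suspension cobordism equals the Hofer norm.) -/

import Mathlib

open MeasureTheory

/-- The suspension shadow set `Σ_H = {t + i·H(t,x) : t ∈ ℝ, x ∈ L}`. -/
def suspensionShadowSet (L : Type) [TopologicalSpace L] (H : ℝ × L → ℝ) : Set ℂ :=
  {z : ℂ | ∃ t : ℝ, ∃ x : L, z = (t : ℂ) + Complex.I * (H (t, x) : ℂ)}

/-- The relative Hofer norm `‖H‖_L = ∫ (sup_x H(t,x) − inf_x H(t,x)) dt`. -/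
noncomputable def relHoferNorm (L : Type) [TopologicalSpace L] (H : ℝ × L → ℝ) : ℝ :=
  ∫ t : ℝ, ((⨆ x : L, H (t, x)) - ⨅ x : L, H (t, x))

theorem continuous_iSup_of_compactSpace {X L : Type*} [TopologicalSpace X] [TopologicalSpace L]
    [CompactSpace L] {H : X × L → ℝ} (hH : Continuous H) :
    Continuous fun t => ⨆ x, H (t, x) := by
  simpa only [Set.image_univ, sSup_range] using
    isCompact_univ.continuous_sSup (f := fun t x => H (t, x)) hH

theorem continuous_iInf_of_compactSpace {X L : Type*} [TopologicalSpace X] [TopologicalSpace L]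
    [CompactSpace L] {H : X × L → ℝ} (hH : Continuous H) :
    Continuous fun t => ⨅ x, H (t, x) := by
  simpa only [Set.image_univ, sInf_range] using
    isCompact_univ.continuous_sInf (f := fun t x => H (t, x)) hH

theorem hasCompactSupport_iSup_sub_iInf {X L : Type*} [TopologicalSpace X] [R1Space X]
    [TopologicalSpace L] [Nonempty L] {H : X × L → ℝ} (hH : HasCompactSupport H) :
    HasCompactSupport fun t => (⨆ x, H (t, x)) - ⨅ x, H (t, x) := by
  refine HasCompactSupport.intro (hH.isCompact.image continuous_fst) fun t ht => ?_
  have h0 (x : L) : H (t, x) = 0 :=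
    image_eq_zero_of_notMem_tsupport fun hx => ht ⟨(t, x), hx, rfl⟩
  simp [h0]

/-- The open region between the graphs of `a` and `b`, as a subset of the complex plane. -/
def complexStrip (a b : ℝ → ℝ) : Set ℂ :=
  {z | a z.re < z.im ∧ z.im < b z.re}

theorem isOpen_complexStrip {a b : ℝ → ℝ} (ha : Continuous a) (hb : Continuous b) :
    IsOpen (complexStrip a b) :=
  (isOpen_lt (ha.comp Complex.continuous_re) Complex.continuous_im).inter
    (isOpen_lt Complex.continuous_im (hb.comp Complex.continuous_re))

/-- The fibrewise affine homeomorphism of the plane that takes the region between the graphs of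
`a` and `b` to `ℝ × (0, 1)`. -/
noncomputable def straightenStrip {a b : ℝ → ℝ} (ha : Continuous a) (hb : Continuous b)
    (hab : ∀ t, a t < b t) : ℂ ≃ₜ ℝ × ℝ where
  toFun z := (z.re, (z.im - a z.re) / (b z.re - a z.re))
  invFun p := ⟨p.1, a p.1 + p.2 * (b p.1 - a p.1)⟩
  left_inv z := by
    have := (sub_pos.2 (hab z.re)).ne'
    apply Complex.ext
    · rfl
    · simp only
      field_simp
      ring
  right_inv p := by
    have := (sub_pos.2 (hab p.1)).ne'
    ext
    · rfl
    · simp only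
      field_simp
      ring
  continuous_toFun := by
    refine Complex.continuous_re.prodMk (Continuous.div ?_ ?_ fun z =>
      (sub_pos.2 (hab z.re)).ne') <;> fun_prop
  continuous_invFun := by
    have h : Continuous fun p : ℝ × ℝ => (p.1, a p.1 + p.2 * (b p.1 - a p.1)) := by fun_prop
    exact Complex.equivRealProdCLM.symm.continuous.comp h

theorem simplyConnectedSpace_complexStrip {a b : ℝ → ℝ} (ha : Continuous a) (hb : Continuous b)
    (hab : ∀ t, a t < b t) : SimplyConnectedSpace (complexStrip a b) := by
  let S : Set (ℝ × ℝ) := Set.univ ×ˢ Set.Ioo 0 1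
  have hS : ContractibleSpace S :=
    (convex_univ.prod (convex_Ioo 0 1)).contractibleSpace ⟨(0, 1 / 2), by norm_num [S]⟩
  have e : complexStrip a b ≃ₜ S := (straightenStrip ha hb hab).subtype fun z => by
    have h := sub_pos.2 (hab z.re)
    change a z.re < z.im ∧ z.im < b z.re ↔
      (z.re, (z.im - a z.re) / (b z.re - a z.re)) ∈ S
    simp [S, div_pos_iff_of_pos_right h, div_lt_one h]
  have := e.contractibleSpace
  infer_instance

theorem volume_complexStrip {a b : ℝ → ℝ} (ha : Continuous a) (hb : Continuous b)
    (hab : ∀ t, a t < b t) (hint : Integrable fun t => b t - a t) :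
    volume (complexStrip a b) = ENNReal.ofReal (∫ t, b t - a t) := by
  have h : complexStrip a b =
      Complex.measurableEquivRealProd ⁻¹' regionBetween a b Set.univ := by
    ext z
    simp [complexStrip, regionBetween, Complex.measurableEquivRealProd_apply]
  rw [h, Complex.volume_preserving_equiv_real_prod.measure_preimage_equiv,
    Measure.volume_eq_prod, volume_regionBetween_eq_lintegral ha.aemeasurable hb.aemeasurable
      MeasurableSet.univ, Measure.restrict_univ,
    ofReal_integral_eq_lintegral_ofReal hint (.of_forall fun t => (sub_pos.2 (hab t)).le)]
  rfl

/-- For every `ε > 0` there is an open simply connected set `U ⊆ ℂ` containing the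
suspension shadow set with Lebesgue measure strictly less than `‖H‖_L + ε`. -/
theorem exists_open_simplyConnected_superset_volume_lt
    (L : Type) [TopologicalSpace L] [CompactSpace L] [ConnectedSpace L] [Nonempty L]
    (H : ℝ × L → ℝ) (hH : Continuous H) (hsupp : HasCompactSupport H) :
    ∀ ε : ℝ, 0 < ε → ∃ U : Set ℂ, IsOpen U ∧ SimplyConnectedSpace U ∧
      suspensionShadowSet L H ⊆ U ∧ volume U < ENNReal.ofReal (relHoferNorm L H + ε) := by
  intro ε hε
  have hM := continuous_iSup_of_compactSpace hH
  have hm := continuous_iInf_of_compactSpace hH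
  have hint : Integrable fun t => (⨆ x, H (t, x)) - ⨅ x, H (t, x) :=
    (hM.sub hm).integrable_of_hasCompactSupport (hasCompactSupport_iSup_sub_iInf hsupp)
  let g : ℝ → ℝ := fun t => ε / 8 * (1 + t ^ 2)⁻¹
  have hg0 (t : ℝ) : 0 < g t := by positivity
  have hg : Continuous g :=
    continuous_const.mul (Continuous.inv₀ (by fun_prop) fun t => by positivity)
  have hgint : Integrable g := integrable_inv_one_add_sq.const_mul _
  have hlow (t : ℝ) (x : L) : ⨅ x, H (t, x) ≤ H (t, x) :=
    ciInf_le (isCompact_range (hH.comp (Continuous.prodMk_right t))).bddBelow x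
  have hup (t : ℝ) (x : L) : H (t, x) ≤ ⨆ x, H (t, x) :=
    le_ciSup (isCompact_range (hH.comp (Continuous.prodMk_right t))).bddAbove x
  have hle (t : ℝ) : ⨅ x, H (t, x) ≤ ⨆ x, H (t, x) :=
    (hlow t (Classical.arbitrary L)).trans (hup t _)
  let a : ℝ → ℝ := fun t => (⨅ x, H (t, x)) - g t
  let b : ℝ → ℝ := fun t => (⨆ x, H (t, x)) + g t
  have ha : Continuous a := hm.sub hg
  have hb : Continuous b := hM.add hg
  have hab (t : ℝ) : a t < b t := by
    simp only [a, b]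
    linarith [hle t, hg0 t]
  have hba : (fun t => b t - a t) =
      fun t => ((⨆ x, H (t, x)) - ⨅ x, H (t, x)) + 2 * g t := by
    funext t
    simp only [a, b]
    ring
  refine ⟨complexStrip a b, isOpen_complexStrip ha hb,
    simplyConnectedSpace_complexStrip ha hb hab, ?_, ?_⟩
  · rintro _ ⟨t, x, rfl⟩
    simp only [complexStrip, Set.mem_ofPred_eq, a, b]
    constructor <;> simp <;> linarith [hlow t x, hup t x, hg0 t]
  · rw [volume_complexStrip ha hb hab (hba ▸ hint.add (hgint.const_mul 2)), hba,
      integral_add hint (hgint.const_mul 2), integral_const_mul, integral_const_mul,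
      integral_univ_inv_one_add_sq]
    have hnorm : 0 ≤ relHoferNorm L H := integral_nonneg fun t => sub_nonneg.2 (hle t)
    refine (ENNReal.ofReal_lt_ofReal_iff (by linarith)).2 (add_lt_add_right ?_ _)
    nlinarith [Real.pi_lt_four]
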